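/- With the same setup as the motivational example (dim V = 3, q a primitive nth root of unity), the maps σ, D₁, D₂ defined on basis elements by σ(w₁ⁱw₂ʲw₃ᵐ g) = qⁱ χ₁(g⁻¹) w₁ⁱw₂ʲw₃ᵐ g, D₁(w₁ⁱw₂ʲw₃ᵐ g) = (i)_q q^{j+m} χ₁(g⁻¹) w₁^{i−1}w₂ʲw₃ᵐ σ₂ g, D₂(w₁ⁱw₂ʲw₃ᵐ g) = (j)_{q⁻¹} qⁱ w₁ⁱw₂^{j−1}w₃^{m+1} σ₁σ₂⁻¹ g satisfy q·σ∘D₁ = D₁∘σ and q·σ∘D₂ = D₂∘σ as linear maps on S_q(V)#G. -/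

import Mathlib

/-- The underlying vector space of `S_q(V)#G` in the motivational example: it has basis
`{w₁ⁱ w₂ʲ w₃ᵐ g}` indexed by `(i,j,m) ∈ ℕ³` and `g = σ₁^a σ₂^b ∈ G = (ℤ/n)²`. -/
abbrev SmashSpace (n : ℕ) := (ℕ × ℕ × ℕ × (ZMod n × ZMod n)) →₀ ℂ

/-- The quantum integer `(m)_q = 1 + q + ⋯ + q^(m−1)`. -/
noncomputable def qInt (q : ℂ) (m : ℕ) : ℂ := ∑ i ∈ Finset.range m, q ^ i

/-- The character `χ₁ : G → ℂˣ` evaluated at `g⁻¹`, for `g = σ₁^a σ₂^b`: since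
`σ₁(w₁) = q w₁` and `σ₂(w₁) = w₁`, we have `χ₁(g) = q^a`, so `χ₁(g⁻¹) = q^((−a).val)`. -/
noncomputable def chi1inv (n : ℕ) (q : ℂ) (g : ZMod n × ZMod n) : ℂ := q ^ (-g.1).val

/-- `D₁` on basis elements: `D₁(w₁ⁱw₂ʲw₃ᵐ g) = (i)_q q^(j+m) χ₁(g⁻¹) w₁^(i−1)w₂ʲw₃ᵐ σ₂ g`
(a negative exponent is interpreted as `0`; indeed `(0)_q = 0`). -/
noncomputable def D1fun (n : ℕ) (q : ℂ) :
    ℕ × ℕ × ℕ × (ZMod n × ZMod n) → SmashSpace n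
  | (i, j, m, (a, b)) =>
      (qInt q i * q ^ (j + m) * chi1inv n q (a, b)) •
        Finsupp.single (i - 1, j, m, (a, b + 1)) 1

/-- `D₂` on basis elements: `D₂(w₁ⁱw₂ʲw₃ᵐ g) = (j)_{q⁻¹} qⁱ w₁ⁱw₂^(j−1)w₃^(m+1) σ₁σ₂⁻¹ g`. -/
noncomputable def D2fun (n : ℕ) (q : ℂ) :
    ℕ × ℕ × ℕ × (ZMod n × ZMod n) → SmashSpace n
  | (i, j, m, (a, b)) =>
      (qInt q⁻¹ j * q ^ i) • Finsupp.single (i, j - 1, m + 1, (a + 1, b - 1)) 1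

/-- `σ` on basis elements: `σ(w₁ⁱw₂ʲw₃ᵐ g) = qⁱ χ₁(g⁻¹) w₁ⁱw₂ʲw₃ᵐ g`. -/
noncomputable def sigmafun (n : ℕ) (q : ℂ) :
    ℕ × ℕ × ℕ × (ZMod n × ZMod n) → SmashSpace n
  | (i, j, m, (a, b)) =>
      (q ^ i * chi1inv n q (a, b)) • Finsupp.single (i, j, m, (a, b)) 1

/-- The `ℂ`-linear extension of a map defined on the monomial basis. -/
noncomputable def extend (n : ℕ)
    (f : ℕ × ℕ × ℕ × (ZMod n × ZMod n) → SmashSpace n) :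
    SmashSpace n →ₗ[ℂ] SmashSpace n :=
  Finsupp.lsum ℂ fun p => LinearMap.toSpanSingleton ℂ (SmashSpace n) (f p)

theorem extend_single (n : ℕ) (f : ℕ × ℕ × ℕ × (ZMod n × ZMod n) → SmashSpace n)
    (p : ℕ × ℕ × ℕ × (ZMod n × ZMod n)) :
    extend n f (Finsupp.single p 1) = f p := by
  simp [extend]

theorem chi_shift (n : ℕ) (hn : 2 ≤ n) (q : ℂ) (hq : IsPrimitiveRoot q n) (a b c : ZMod n) :
    q * chi1inv n q (a + 1, b) = chi1inv n q (a, c) := by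
  have : NeZero n := ⟨by omega⟩
  unfold chi1inv
  rw [← pow_succ']
  have h : (-(a + 1)).val + 1 ≡ (-a).val [MOD n] := by
    rw [← ZMod.natCast_eq_natCast_iff]
    push_cast
    simp
  have h2 : ∀ k : ℕ, q ^ k = q ^ (k % n) := fun k => by
    conv_lhs => rw [← Nat.mod_add_div k n, pow_add, pow_mul, hq.pow_eq_one, one_pow, mul_one]
  change q ^ ((-(a + 1)).val + 1) = q ^ (-a).val
  rw [h2 ((-(a + 1)).val + 1), h2 (-a).val, h]

/-- In the motivational example, the maps `σ, D₁, D₂` defined on the basis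
`{w₁ⁱ w₂ʲ w₃ᵐ g}` by the stated formulas satisfy `q·σ∘D₁ = D₁∘σ` and `q·σ∘D₂ = D₂∘σ`
as linear maps on `S_q(V)#G`. -/
theorem motivational_sigma_skew_commutation
    (n : ℕ) (hn : 2 ≤ n) (q : ℂ) (hq : IsPrimitiveRoot q n) :
    q • ((extend n (sigmafun n q)) ∘ₗ (extend n (D1fun n q))) =
      (extend n (D1fun n q)) ∘ₗ (extend n (sigmafun n q)) ∧
    q • ((extend n (sigmafun n q)) ∘ₗ (extend n (D2fun n q))) =
      (extend n (D2fun n q)) ∘ₗ (extend n (sigmafun n q)) := by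
  constructor
  · refine Finsupp.lhom_ext' fun p => LinearMap.ext_ring ?_
    obtain ⟨i, j, m, a, b⟩ := p
    simp only [LinearMap.comp_apply, LinearMap.smul_apply, Finsupp.lsingle_apply, extend_single,
      D1fun, sigmafun, map_smul, smul_smul]
    cases i with
    | zero => simp [qInt]
    | succ i =>
      congr 1
      simp only [chi1inv, Nat.add_sub_cancel]
      ring
  · refine Finsupp.lhom_ext' fun p => LinearMap.ext_ring ?_
    obtain ⟨i, j, m, a, b⟩ := p
    simp only [LinearMap.comp_apply, LinearMap.smul_apply, Finsupp.lsingle_apply, extend_single,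
      D2fun, sigmafun, map_smul, smul_smul]
    congr 1
    rw [← chi_shift n hn q hq a (b - 1) b]
    ring
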